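/- Let X : [0,T] → ℝ^d be continuously differentiable with time-augmentation X̂, let N ≥ 1, and let (ℓ_I) be real coefficients indexed by the multi-indices I over {0,1,…,d} of length at most N. Define σ_t = Σ_{|I|≤N} ℓ_I S(X̂)^I_{0,t}. Then for all t ∈ [0,T], ∫_0^t σ_s² ds = Σ_{|I|≤N} Σ_{|J|≤N} ℓ_I ℓ_J ⟨(e_I ⧢ e_J) · e_0, S(X̂)_{0,t}⟩, where for a finite linear combination of words ℓ = Σ_K c_K e_K one sets ⟨ℓ, S(X̂)_{0,t}⟩ = Σ_K c_K S(X̂)^K_{0,t}, ⧢ is the shuffle product, and · e_0 denotes appending the time letter 0 at the end of each word. -/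

import Mathlib

open MeasureTheory

/-- The signature coefficient `S(X)^I_{s,t}` of a path `X : ℝ → ℝ^d` over `[s,t]`,
for a multi-index (word) `I = (i_1,…,i_n)`: the iterated integral
`∫_{s<u_1<⋯<u_n<t} X'_{i_1}(u_1)⋯X'_{i_n}(u_n) du`; for `I = ∅` it equals `1`. -/
noncomputable def sigCoeff {d : ℕ} (X : ℝ → Fin d → ℝ) (s t : ℝ) (I : List (Fin d)) : ℝ :=
  ∫ u in {u : Fin I.length → ℝ |
      (∀ a b : Fin I.length, a < b → u a < u b) ∧ ∀ a, u a ∈ Set.Ioo s t},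
    ∏ a : Fin I.length, deriv (fun r => X r (I.get a)) (u a)

/-- The time-augmented path `X̂_t = (t, X_t) ∈ ℝ^{1+d}`, with coordinate `0` being time. -/
noncomputable def timeAug {d : ℕ} (X : ℝ → Fin d → ℝ) : ℝ → Fin (d + 1) → ℝ :=
  fun t => Fin.cons t (X t)

/-- The shuffle product of two words, as the list (with multiplicity) of all their
shuffles, so that `e_I ⧢ e_J = Σ_{K ∈ shuffle I J} e_K`. -/
def shuffle {α : Type*} : List α → List α → List (List α)
  | [], J => [J]
  | a :: I, [] => [a :: I]
  | a :: I, b :: J =>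
      ((shuffle I (b :: J)).map (List.cons a)) ++ ((shuffle (a :: I) J).map (List.cons b))
termination_by I J => I.length + J.length

/-- The iterated integral over the increasing tuples in `(s, t)` of a tensor product of functions,
computed by integrating out the smallest variable last. -/
noncomputable def iterInt {α : Type*} (g : α → ℝ → ℝ) (t : ℝ) : List α → ℝ → ℝ
  | [], _ => 1
  | a :: I, s => ∫ u in s..t, g a u * iterInt g t I u

lemma continuous_iterInt_uncurry {α : Type*} {g : α → ℝ → ℝ} (hg : ∀ a, Continuous (g a))
    (I : List α) : Continuous fun p : ℝ × ℝ => iterInt g p.1 I p.2 := by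
  induction I with
  | nil => exact continuous_const
  | cons a I ih =>
    have h : Continuous (Function.uncurry fun (p : ℝ × ℝ) (u : ℝ) =>
        g a u * iterInt g p.1 I u) :=
      ((hg a).comp continuous_snd).mul
        (ih.comp ((continuous_fst.comp continuous_fst).prodMk continuous_snd))
    have hint : ∀ (p : ℝ × ℝ) (x y : ℝ),
        IntervalIntegrable (fun u => g a u * iterInt g p.1 I u) volume x y := fun p x y =>
      (h.comp (Continuous.prodMk_right p)).intervalIntegrable x y
    have hsplit : (fun p : ℝ × ℝ => iterInt g p.1 (a :: I) p.2) = fun p =>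
        (∫ u in (0 : ℝ)..p.1, g a u * iterInt g p.1 I u) -
          ∫ u in (0 : ℝ)..p.2, g a u * iterInt g p.1 I u := by
      funext p
      exact (intervalIntegral.integral_interval_sub_left (hint p _ _) (hint p _ _)).symm
    rw [hsplit]
    exact (intervalIntegral.continuous_parametric_intervalIntegral_of_continuous h
      continuous_fst).sub
      (intervalIntegral.continuous_parametric_intervalIntegral_of_continuous h continuous_snd)

lemma continuous_iterInt {α : Type*} {g : α → ℝ → ℝ} (hg : ∀ a, Continuous (g a))
    (t : ℝ) (I : List α) : Continuous (iterInt g t I) :=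
  (continuous_iterInt_uncurry hg I).comp (Continuous.prodMk_right t)

lemma continuous_iterInt_endpoint {α : Type*} {g : α → ℝ → ℝ} (hg : ∀ a, Continuous (g a))
    (I : List α) (s : ℝ) : Continuous fun t => iterInt g t I s :=
  (continuous_iterInt_uncurry hg I).comp (Continuous.prodMk_left s)

lemma iterInt_cons_self {α : Type*} (g : α → ℝ → ℝ) (t : ℝ) (a : α) (I : List α) :
    iterInt g t (a :: I) t = 0 :=
  intervalIntegral.integral_same

lemma hasDerivAt_iterInt_cons {α : Type*} {g : α → ℝ → ℝ} (hg : ∀ a, Continuous (g a))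
    (t : ℝ) (a : α) (I : List α) (s : ℝ) :
    HasDerivAt (iterInt g t (a :: I)) (-(g a s * iterInt g t I s)) s := by
  have h : Continuous fun u => g a u * iterInt g t I u := (hg a).mul (continuous_iterInt hg t I)
  exact intervalIntegral.integral_hasDerivAt_left (h.intervalIntegrable _ _)
    h.aestronglyMeasurable.stronglyMeasurableAtFilter h.continuousAt

lemma sum_map_iterInt_cons {α : Type*} {g : α → ℝ → ℝ} (hg : ∀ a, Continuous (g a))
    (t : ℝ) (a : α) (L : List (List α)) (s : ℝ) :
    ((L.map (List.cons a)).map fun K => iterInt g t K s).sum =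
      ∫ u in s..t, g a u * (L.map fun K => iterInt g t K u).sum := by
  induction L with
  | nil => simp
  | cons K L ih =>
    have h1 : Continuous fun u => g a u * iterInt g t K u :=
      (hg a).mul (continuous_iterInt hg t K)
    have h2 : Continuous fun u => g a u * (L.map fun K => iterInt g t K u).sum :=
      (hg a).mul (continuous_list_sum L fun K _ => continuous_iterInt hg t K)
    simp only [List.map_cons, List.sum_cons, mul_add, ih]
    rw [intervalIntegral.integral_add (h1.intervalIntegrable _ _) (h2.intervalIntegrable _ _)]
    rfl

/-- Iterated integrals satisfy the shuffle identity. -/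
lemma iterInt_mul_iterInt {α : Type*} {g : α → ℝ → ℝ} (hg : ∀ a, Continuous (g a))
    (t : ℝ) (I J : List α) (s : ℝ) :
    iterInt g t I s * iterInt g t J s = ((shuffle I J).map fun K => iterInt g t K s).sum := by
  induction I, J using shuffle.induct generalizing s with
  | case1 J => simp [shuffle, iterInt]
  | case2 a I => simp [shuffle, iterInt]
  | case3 a I b J ih1 ih2 =>
    have hI : Continuous fun u => g a u * (iterInt g t I u * iterInt g t (b :: J) u) :=
      (hg a).mul ((continuous_iterInt hg t I).mul (continuous_iterInt hg t _))
    have hJ : Continuous fun u => g b u * (iterInt g t (a :: I) u * iterInt g t J u) :=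
      (hg b).mul ((continuous_iterInt hg t _).mul (continuous_iterInt hg t J))
    rw [shuffle, List.map_append, List.sum_append, sum_map_iterInt_cons hg,
      sum_map_iterInt_cons hg]
    simp only [← ih1, ← ih2]
    rw [← intervalIntegral.integral_add (hI.intervalIntegrable _ _) (hJ.intervalIntegrable _ _),
      intervalIntegral.integral_eq_sub_of_hasDerivAt
        (f := fun u => -(iterInt g t (a :: I) u * iterInt g t (b :: J) u))]
    · simp [iterInt_cons_self]
    · intro u _
      have h := ((hasDerivAt_iterInt_cons hg t a I u).mul
        (hasDerivAt_iterInt_cons hg t b J u)).neg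
      exact h.congr_deriv (by ring)
    · exact (hI.add hJ).intervalIntegrable _ _

/-- Fubini's theorem on the triangle `s < u < r ≤ t`. -/
lemma intervalIntegral_swap_triangle {F : ℝ → ℝ → ℝ} (hF : Continuous (Function.uncurry F))
    {s t : ℝ} (hst : s ≤ t) :
    ∫ u in s..t, ∫ r in u..t, F u r = ∫ r in s..t, ∫ u in s..r, F u r := by
  set G : ℝ → ℝ → ℝ := fun u r => {p : ℝ × ℝ | p.1 < p.2}.indicator (Function.uncurry F) (u, r)
    with hG
  have hmeas : MeasurableSet {p : ℝ × ℝ | p.1 < p.2} :=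
    measurableSet_lt measurable_fst measurable_snd
  have hint : IntegrableOn (Function.uncurry G) (Set.uIoc s t ×ˢ Set.uIoc s t) := by
    have : IntegrableOn (Function.uncurry F) (Set.uIoc s t ×ˢ Set.uIoc s t) :=
      (hF.continuousOn.integrableOn_compact (isCompact_uIcc.prod isCompact_uIcc)).mono_set
        (Set.prod_mono Set.uIoc_subset_uIcc Set.uIoc_subset_uIcc)
    exact Integrable.indicator this hmeas
  have h1 : ∀ u ∈ Set.Icc s t, ∫ r in s..t, G u r = ∫ r in u..t, F u r := by
    intro u hu
    have hGu : G u = (Set.Ioi u).indicator (F u) := by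
      funext r; simp [hG, Set.indicator, Function.uncurry]
    rw [intervalIntegral.integral_of_le hst, intervalIntegral.integral_of_le hu.2, hGu,
      setIntegral_indicator measurableSet_Ioi, Set.Ioc_inter_Ioi, sup_of_le_right hu.1]
  have h2 : ∀ r ∈ Set.Icc s t, ∫ u in s..t, G u r = ∫ u in s..r, F u r := by
    intro r hr
    have hGr : (fun u => G u r) = (Set.Iio r).indicator (fun u => F u r) := by
      funext u; simp [hG, Set.indicator, Function.uncurry]
    have hset : Set.Ioc s t ∩ Set.Iio r = Set.Ioo s r := by
      ext u
      simp only [Set.mem_inter_iff, Set.mem_Ioc, Set.mem_Iio, Set.mem_Ioo]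
      exact ⟨fun h => ⟨h.1.1, h.2⟩, fun h => ⟨⟨h.1, h.2.le.trans hr.2⟩, h.2⟩⟩
    rw [intervalIntegral.integral_of_le hst, intervalIntegral.integral_of_le hr.1, hGr,
      setIntegral_indicator measurableSet_Iio, hset, integral_Ioc_eq_integral_Ioo]
  rw [← intervalIntegral.integral_congr (g := fun u => ∫ r in u..t, F u r)
      (fun u hu => h1 u (Set.uIcc_of_le hst ▸ hu)),
    ← intervalIntegral.integral_congr (g := fun r => ∫ u in s..r, F u r)
      (fun r hr => h2 r (Set.uIcc_of_le hst ▸ hr))]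
  exact intervalIntegral_intervalIntegral_swap hint

/-- Appending a letter at the end of a word integrates over the right endpoint. -/
lemma iterInt_append_singleton {α : Type*} {g : α → ℝ → ℝ} (hg : ∀ a, Continuous (g a))
    (z : α) (I : List α) {s t : ℝ} (hst : s ≤ t) :
    iterInt g t (I ++ [z]) s = ∫ r in s..t, iterInt g r I s * g z r := by
  induction I generalizing s with
  | nil => simp [iterInt]
  | cons a I ih =>
    have hF : Continuous (Function.uncurry fun u r => g a u * (iterInt g r I u * g z r)) :=
      ((hg a).comp continuous_fst).mul (((continuous_iterInt_uncurry hg I).comp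
        (continuous_snd.prodMk continuous_fst)).mul ((hg z).comp continuous_snd))
    calc iterInt g t (a :: I ++ [z]) s
        = ∫ u in s..t, ∫ r in u..t, g a u * (iterInt g r I u * g z r) := by
          refine intervalIntegral.integral_congr fun u hu => ?_
          rw [Set.uIcc_of_le hst] at hu
          simp only [intervalIntegral.integral_const_mul]
          rw [← ih hu.2]
          rfl
      _ = ∫ r in s..t, ∫ u in s..r, g a u * (iterInt g r I u * g z r) :=
          intervalIntegral_swap_triangle hF hst
      _ = ∫ r in s..t, iterInt g r (a :: I) s * g z r := by
          simp only [← mul_assoc, intervalIntegral.integral_mul_const, iterInt]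

/-- The increasing tuples with entries in `(s, t)`. -/
def openSimplex (n : ℕ) (s t : ℝ) : Set (Fin n → ℝ) :=
  {u | (∀ a b, a < b → u a < u b) ∧ ∀ a, u a ∈ Set.Ioo s t}

lemma measurableSet_openSimplex (n : ℕ) (s t : ℝ) : MeasurableSet (openSimplex n s t) := by
  have : openSimplex n s t = (⋂ a, ⋂ b, ⋂ _ : a < b, {u : Fin n → ℝ | u a < u b}) ∩
      ⋂ a, (fun u : Fin n → ℝ => u a) ⁻¹' Set.Ioo s t := by
    ext u; simp [openSimplex]
  rw [this]
  refine MeasurableSet.inter ?_ (.iInter fun a => measurable_pi_apply a measurableSet_Ioo)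
  exact .iInter fun a => .iInter fun b => .iInter fun _ =>
    measurableSet_lt (measurable_pi_apply a) (measurable_pi_apply b)

lemma cons_mem_openSimplex {n : ℕ} {s t x : ℝ} {u : Fin n → ℝ} :
    (Fin.cons x u : Fin (n + 1) → ℝ) ∈ openSimplex (n + 1) s t ↔
      x ∈ Set.Ioo s t ∧ u ∈ openSimplex n x t := by
  simp only [openSimplex, Set.mem_ofPred_eq, Fin.forall_fin_succ, Fin.cons_zero, Fin.cons_succ,
    Set.mem_Ioo, Fin.succ_lt_succ_iff, Fin.succ_pos, Fin.not_lt_zero,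
    false_imp_iff, true_imp_iff, true_and]
  constructor
  · rintro ⟨⟨h1, h2⟩, h3, h4⟩
    exact ⟨h3, h2, fun a => ⟨h1 a, (h4 a).2⟩⟩
  · rintro ⟨h1, h2, h3⟩
    exact ⟨⟨fun a => (h3 a).1, h2⟩, h1, fun a => ⟨h1.1.trans (h3 a).1, (h3 a).2⟩⟩

lemma integrable_indicator_openSimplex {n : ℕ} {F : (Fin n → ℝ) → ℝ} (hF : Continuous F)
    (s t : ℝ) : Integrable ((openSimplex n s t).indicator F) := by
  rw [integrable_indicator_iff (measurableSet_openSimplex n s t)]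
  refine (hF.continuousOn.integrableOn_compact
    (isCompact_univ_pi fun _ : Fin n => isCompact_Icc (a := s) (b := t))).mono_set ?_
  exact fun u hu a _ => Set.Ioo_subset_Icc_self (hu.2 a)

/-- Integrating out the smallest variable last in an integral over the open simplex. -/
lemma setIntegral_openSimplex_succ {n : ℕ} {f : Fin (n + 1) → ℝ → ℝ}
    (hf : ∀ i, Continuous (f i)) {s t : ℝ} (hst : s ≤ t) :
    ∫ u in openSimplex (n + 1) s t, ∏ i, f i (u i) =
      ∫ x in s..t, f 0 x * ∫ u in openSimplex n x t, ∏ i, f i.succ (u i) := by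
  set F : (Fin (n + 1) → ℝ) → ℝ :=
    (openSimplex (n + 1) s t).indicator fun u => ∏ i, f i (u i) with hFdef
  have hF : Integrable F := integrable_indicator_openSimplex
    (continuous_finsetProd _ fun i _ => (hf i).comp (continuous_apply i)) s t
  have hmp := (volume_preserving_piFinSuccAbove (fun _ : Fin (n + 1) => ℝ) 0).symm
  have hcons : ∀ p : ℝ × (Fin n → ℝ),
      F ((MeasurableEquiv.piFinSuccAbove (fun _ : Fin (n + 1) => ℝ) 0).symm p) =
        (Set.Ioo s t).indicator (fun x => f 0 x *
          (openSimplex n x t).indicator (fun u => ∏ i, f i.succ (u i)) p.2) p.1 := by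
    rintro ⟨x, u⟩
    have he : (MeasurableEquiv.piFinSuccAbove (fun _ : Fin (n + 1) => ℝ) 0).symm (x, u) =
        Fin.cons x u := Fin.insertNth_zero' x u
    rw [he, hFdef]
    by_cases hx : x ∈ Set.Ioo s t <;> by_cases hu : u ∈ openSimplex n x t <;>
      simp only [Set.indicator, cons_mem_openSimplex, hx, hu, and_true, and_false, if_true,
        if_false, mul_zero, Fin.prod_univ_succ, Fin.cons_zero, Fin.cons_succ]
  have hint : Integrable fun p => F
      ((MeasurableEquiv.piFinSuccAbove (fun _ : Fin (n + 1) => ℝ) 0).symm p) :=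
    (hmp.integrable_comp_emb (MeasurableEquiv.measurableEmbedding _)).2 hF
  rw [← integral_indicator (measurableSet_openSimplex _ _ _), ← hFdef,
    ← hmp.integral_comp (MeasurableEquiv.measurableEmbedding _),
    Measure.volume_eq_prod, integral_prod _ hint, intervalIntegral.integral_of_le hst,
    integral_Ioc_eq_integral_Ioo, ← integral_indicator measurableSet_Ioo]
  refine integral_congr_ae (.of_forall fun x => ?_)
  simp only [hcons]
  by_cases hx : x ∈ Set.Ioo s t
  · simp only [Set.indicator_of_mem hx, integral_const_mul,
      integral_indicator (measurableSet_openSimplex _ _ _)]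
  · simp only [Set.indicator_of_notMem hx, integral_zero]

lemma sigCoeff_eq_iterInt {d : ℕ} {X : ℝ → Fin d → ℝ}
    (hX : ∀ i, Continuous (deriv fun r => X r i)) (I : List (Fin d)) {s t : ℝ} (hst : s ≤ t) :
    sigCoeff X s t I = iterInt (fun i => deriv fun r => X r i) t I s := by
  induction I generalizing s with
  | nil =>
    have h : {u : Fin ([] : List (Fin d)).length → ℝ |
        (∀ a b, a < b → u a < u b) ∧ ∀ a, u a ∈ Set.Ioo s t} = Set.univ := by
      ext u
      exact iff_of_true ⟨fun a => a.elim0, fun a => a.elim0⟩ trivial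
    rw [sigCoeff, h]
    simp [iterInt, measureReal_def, volume_pi]
  | cons a I ih =>
    refine (setIntegral_openSimplex_succ
      (f := fun i => deriv fun r => X r ((a :: I).get i)) (fun i => hX _) hst).trans ?_
    refine intervalIntegral.integral_congr fun u hu => ?_
    rw [Set.uIcc_of_le hst] at hu
    exact congrArg _ (ih hu.2)

lemma deriv_timeAug_zero {d : ℕ} (X : ℝ → Fin d → ℝ) (u : ℝ) :
    deriv (fun r => timeAug X r 0) u = 1 := by
  simp [timeAug]

lemma continuous_deriv_timeAug {d : ℕ} {X : ℝ → Fin d → ℝ} (hX : ContDiff ℝ 1 X)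
    (i : Fin (d + 1)) : Continuous (deriv fun r => timeAug X r i) := by
  refine Fin.cases ?_ (fun j => ?_) i
  · rw [funext (deriv_timeAug_zero X)]
    exact continuous_const
  · exact (contDiff_pi.1 hX j).continuous_deriv le_rfl

/-- The time integral of a product of two signature coefficients of the time-augmented path. -/
lemma integral_sigCoeff_timeAug_mul {d : ℕ} {X : ℝ → Fin d → ℝ} (hX : ContDiff ℝ 1 X)
    {t : ℝ} (ht : 0 ≤ t) (I J : List (Fin (d + 1))) :
    ∫ s in (0 : ℝ)..t, sigCoeff (timeAug X) 0 s I * sigCoeff (timeAug X) 0 s J =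
      ((shuffle I J).map fun K => sigCoeff (timeAug X) 0 t (K ++ [0])).sum := by
  have hg := continuous_deriv_timeAug hX
  rw [intervalIntegral.integral_congr (g := fun s => ((shuffle I J).map fun K =>
    iterInt (fun i => deriv fun r => timeAug X r i) s K 0).sum)]
  · induction shuffle I J with
    | nil => simp
    | cons K L ih =>
      simp only [List.map_cons, List.sum_cons]
      rw [intervalIntegral.integral_add
        ((continuous_iterInt_endpoint hg K 0).intervalIntegrable _ _)
        ((continuous_list_sum L fun K _ =>
          continuous_iterInt_endpoint hg K 0).intervalIntegrable _ _), ih,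
        sigCoeff_eq_iterInt hg _ ht, iterInt_append_singleton hg 0 K ht]
      simp only [deriv_timeAug_zero, mul_one]
  · intro s hs
    rw [Set.uIcc_of_le ht] at hs
    simp only [sigCoeff_eq_iterInt hg _ hs.1, iterInt_mul_iterInt hg]

lemma intervalIntegrable_sigCoeff_timeAug_mul {d : ℕ} {X : ℝ → Fin d → ℝ} (hX : ContDiff ℝ 1 X)
    {t : ℝ} (ht : 0 ≤ t) (I J : List (Fin (d + 1))) :
    IntervalIntegrable (fun s => sigCoeff (timeAug X) 0 s I * sigCoeff (timeAug X) 0 s J)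
      volume 0 t := by
  have hg := continuous_deriv_timeAug hX
  refine ContinuousOn.intervalIntegrable (ContinuousOn.congr
    ((continuous_iterInt_endpoint hg I 0).mul
      (continuous_iterInt_endpoint hg J 0)).continuousOn fun s hs => ?_)
  rw [Set.uIcc_of_le ht] at hs
  simp only [sigCoeff_eq_iterInt hg _ hs.1, Pi.mul_apply]

lemma intervalIntegrable_sum_and_integral_eq {ι : Type*} {S : Finset ι} {f : ι → ℝ → ℝ}
    {c : ι → ℝ} {a b : ℝ}
    (h : ∀ i ∈ S, IntervalIntegrable (f i) volume a b ∧ ∫ x in a..b, f i x = c i) :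
    IntervalIntegrable (fun x => ∑ i ∈ S, f i x) volume a b ∧
      ∫ x in a..b, ∑ i ∈ S, f i x = ∑ i ∈ S, c i := by
  constructor
  · rw [← Finset.sum_fn]
    exact .sum S fun i hi => (h i hi).1
  · rw [intervalIntegral.integral_finsetSum fun i hi => (h i hi).1]
    exact Finset.sum_congr rfl fun i hi => (h i hi).2

/-- **Squared signature volatility via shuffles.** Let `X : [0,T] → ℝ^d` be `C¹` with
time-augmentation `X̂`, let `N ≥ 1`, and let `(ℓ_I)` be coefficients indexed by words of
length `≤ N` over `{0,1,…,d}` (a word of length `n` is encoded as `List.ofFn v` for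
`v : Fin n → Fin (d+1)`).  If `σ_t = Σ_{|I|≤N} ℓ_I S(X̂)^I_{0,t}`, then for all
`t ∈ [0,T]`,
`∫_0^t σ_s² ds = Σ_{|I|≤N} Σ_{|J|≤N} ℓ_I ℓ_J ⟨(e_I ⧢ e_J)·e_0, S(X̂)_{0,t}⟩`. -/
theorem integral_sq_vol_shuffle {d N : ℕ} (hN : 1 ≤ N) (T : ℝ) (hT : 0 ≤ T)
    (X : ℝ → Fin d → ℝ) (hX : ContDiff ℝ 1 X)
    (ℓ : List (Fin (d + 1)) → ℝ) (σ : ℝ → ℝ)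
    (hσ : ∀ s : ℝ, σ s =
      ∑ n ∈ Finset.range (N + 1), ∑ v : Fin n → Fin (d + 1),
        ℓ (List.ofFn v) * sigCoeff (timeAug X) 0 s (List.ofFn v)) :
    ∀ t ∈ Set.Icc (0:ℝ) T,
      (∫ s in (0:ℝ)..t, (σ s) ^ 2) =
        ∑ n ∈ Finset.range (N + 1), ∑ v : Fin n → Fin (d + 1),
        ∑ m ∈ Finset.range (N + 1), ∑ w : Fin m → Fin (d + 1),
          ℓ (List.ofFn v) * ℓ (List.ofFn w) *
            ((shuffle (List.ofFn v) (List.ofFn w)).map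
              (fun K => sigCoeff (timeAug X) 0 t (K ++ [(0 : Fin (d + 1))]))).sum := by
  intro t ht
  have hsq : ∀ s, σ s ^ 2 =
      ∑ n ∈ Finset.range (N + 1), ∑ v : Fin n → Fin (d + 1),
      ∑ m ∈ Finset.range (N + 1), ∑ w : Fin m → Fin (d + 1),
        ℓ (List.ofFn v) * ℓ (List.ofFn w) *
          (sigCoeff (timeAug X) 0 s (List.ofFn v) *
            sigCoeff (timeAug X) 0 s (List.ofFn w)) := by
    intro s
    rw [hσ, sq]
    simp only [Finset.sum_mul]
    simp only [Finset.mul_sum, mul_mul_mul_comm]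
  simp only [hsq]
  refine (intervalIntegrable_sum_and_integral_eq fun n _ =>
    intervalIntegrable_sum_and_integral_eq fun v _ =>
    intervalIntegrable_sum_and_integral_eq fun m _ =>
    intervalIntegrable_sum_and_integral_eq fun w _ => ⟨?_, ?_⟩).2
  · exact (intervalIntegrable_sigCoeff_timeAug_mul hX ht.1 _ _).const_mul _
  · rw [intervalIntegral.integral_const_mul, integral_sigCoeff_timeAug_mul hX ht.1]
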